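/- For r > 3 set θ¹_r = arcsin(1/r) and θ²_r = arcsin(3/r), and define g₁(r) = r³ cos(θ¹_r), g₂(r) = r²(π + 2θ¹_r), g₃(r) = r cos(θ¹_r), g₄(r) = sin(2θ¹_r), g₅(r) = r³ cos(θ²_r), g₆(r) = r²(π − 2θ²_r), g₇(r) = r cos(θ²_r), g₈(r) = sin(2θ²_r), g₉(r) = r²(θ²_r − θ¹_r). Then the functions g₁, ..., g₉ are linearly independent on the interval (3, ∞). -/

import Mathlib

open Real

/-- The nine functions built from `θ¹ᵣ = arcsin (1/r)` and `θ²ᵣ = arcsin (3/r)`. -/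
noncomputable def gTeoC : Fin 9 → ℝ → ℝ :=
  ![fun r => r ^ 3 * Real.cos (Real.arcsin (1 / r)),
    fun r => r ^ 2 * (Real.pi + 2 * Real.arcsin (1 / r)),
    fun r => r * Real.cos (Real.arcsin (1 / r)),
    fun r => Real.sin (2 * Real.arcsin (1 / r)),
    fun r => r ^ 3 * Real.cos (Real.arcsin (3 / r)),
    fun r => r ^ 2 * (Real.pi - 2 * Real.arcsin (3 / r)),
    fun r => r * Real.cos (Real.arcsin (3 / r)),
    fun r => Real.sin (2 * Real.arcsin (3 / r)),
    fun r => r ^ 2 * (Real.arcsin (3 / r) - Real.arcsin (1 / r))]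

theorem aux_cos (a r : ℝ) (ha : 0 < a) (hr : a < r) :
    Real.cos (Real.arcsin (a / r)) = √(r ^ 2 - a ^ 2) / r := by
  have h0 : 0 < r := ha.trans hr
  rw [Real.cos_arcsin]
  have : 1 - (a / r) ^ 2 = (r ^ 2 - a ^ 2) / r ^ 2 := by field_simp
  rw [this, Real.sqrt_div' _ (by positivity), Real.sqrt_sq h0.le]

theorem aux_sin (a r : ℝ) (ha : 0 < a) (hr : a < r) :
    Real.sin (2 * Real.arcsin (a / r)) = 2 * a * √(r ^ 2 - a ^ 2) / r ^ 2 := by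
  have h0 : 0 < r := ha.trans hr
  have h1 : a / r ≤ 1 := by rw [div_le_one h0]; exact hr.le
  have h2 : 0 ≤ a / r := by positivity
  rw [Real.sin_two_mul, aux_cos a r ha hr, Real.sin_arcsin (by linarith) h1]
  field_simp

theorem aux_pos (a r : ℝ) (ha : 0 < a) (hr : a < r) : 0 < √(r ^ 2 - a ^ 2) :=
  Real.sqrt_pos.2 (by nlinarith)

theorem aux_deriv_arcsin (a r : ℝ) (ha : 0 < a) (hr : a < r) :
    HasDerivAt (fun x : ℝ => Real.arcsin (a / x)) (-a / (r * √(r ^ 2 - a ^ 2))) r := by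
  have h0 : 0 < r := ha.trans hr
  have h1 : a / r < 1 := by rw [div_lt_one h0]; exact hr
  have h2 : 0 < a / r := by positivity
  have hs := aux_pos a r ha hr
  have hd : HasDerivAt (fun x : ℝ => a / x) (-a / r ^ 2) r := by
    have := (hasDerivAt_const r a).div (hasDerivAt_id r) h0.ne'
    exact this.congr_deriv (by simp)
  have := (Real.hasDerivAt_arcsin (x := a / r) (by linarith) h1.ne).comp r hd
  refine this.congr_deriv ?_
  rw [← Real.cos_arcsin, aux_cos a r ha hr]
  field_simp

/-- Derivative of the block attached to one of the two lines. -/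
theorem aux_deriv (a p q s k r : ℝ) (ha : 0 < a) (hr : a < r) :
    HasDerivAt (fun x : ℝ => √(x ^ 2 - a ^ 2) * (p + q / x ^ 2 + s / x ^ 4)
        + k * Real.arcsin (a / x))
      ((p * r ^ 6 + (-q - a * k) * r ^ 4 + (2 * a ^ 2 * q - 3 * s) * r ^ 2 + 4 * a ^ 2 * s)
        / (√(r ^ 2 - a ^ 2) * r ^ 5)) r := by
  have h0 : 0 < r := ha.trans hr
  have hs := aux_pos a r ha hr
  have hsq : √(r ^ 2 - a ^ 2) ^ 2 = r ^ 2 - a ^ 2 := Real.sq_sqrt (by nlinarith)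
  have h1 : HasDerivAt (fun x : ℝ => √(x ^ 2 - a ^ 2)) (2 * r / (2 * √(r ^ 2 - a ^ 2))) r := by
    have : HasDerivAt (fun x : ℝ => x ^ 2 - a ^ 2) (2 * r) r := by
      simpa using (hasDerivAt_pow 2 r).sub_const (a ^ 2)
    exact this.sqrt (by nlinarith)
  have h2 : HasDerivAt (fun x : ℝ => q / x ^ 2) (-2 * q / r ^ 3) r := by
    refine ((hasDerivAt_const r q).div (hasDerivAt_pow 2 r) (by positivity)).congr_deriv ?_
    field_simp
    norm_num
    ring
  have h3 : HasDerivAt (fun x : ℝ => s / x ^ 4) (-4 * s / r ^ 5) r := by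
    refine ((hasDerivAt_const r s).div (hasDerivAt_pow 4 r) (by positivity)).congr_deriv ?_
    field_simp
    norm_num
    ring
  have h4 := (h1.mul ((h2.const_add p).add h3)).add
    ((aux_deriv_arcsin a r ha hr).const_mul k)
  refine h4.congr_deriv ?_
  generalize √(r ^ 2 - a ^ 2) = w at *
  simp only [Pi.add_apply]
  field_simp
  rw [hsq]
  ring

open Polynomial in
theorem aux_poly (P Q : ℝ[X]) (h : P ^ 2 * (X - C 9) = Q ^ 2 * (X - C 1)) : P = 0 := by
  by_contra hP
  have h9 : (X - C (9 : ℝ)) ≠ 0 := X_sub_C_ne_zero 9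
  have h1 : (X - C (1 : ℝ)) ≠ 0 := X_sub_C_ne_zero 1
  have hl : P ^ 2 * (X - C 9) ≠ 0 := mul_ne_zero (pow_ne_zero _ hP) h9
  have hr : Q ^ 2 * (X - C 1) ≠ 0 := h ▸ hl
  have := congrArg (rootMultiplicity 9) h
  have e : rootMultiplicity (9 : ℝ) (X - C (1 : ℝ)) = 0 := by
    apply rootMultiplicity_eq_zero
    simp [IsRoot]
    norm_num
  rw [rootMultiplicity_mul hl, rootMultiplicity_mul hr, rootMultiplicity_X_sub_C_self, e,
    ← count_roots, ← count_roots, roots_pow, roots_pow, Multiset.count_nsmul,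
    Multiset.count_nsmul] at this
  omega

open Polynomial in
theorem aux_coeff (a b c d a₂ b₂ c₂ d₂ : ℝ)
    (h : ∀ t : ℝ, 9 < t → (a * t ^ 3 + b * t ^ 2 + c * t + d) ^ 2 * (t - 9)
      = (a₂ * t ^ 3 + b₂ * t ^ 2 + c₂ * t + d₂) ^ 2 * (t - 1)) :
    (a = 0 ∧ b = 0 ∧ c = 0 ∧ d = 0) ∧ (a₂ = 0 ∧ b₂ = 0 ∧ c₂ = 0 ∧ d₂ = 0) := by
  have key : ∀ a b c d : ℝ, (C a * X ^ 3 + C b * X ^ 2 + C c * X + C d : ℝ[X]) = 0 →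
      (a = 0 ∧ b = 0 ∧ c = 0 ∧ d = 0) := by
    intro a b c d h
    have h3 := congrArg (fun p => coeff p 3) h
    have h2 := congrArg (fun p => coeff p 2) h
    have h1 := congrArg (fun p => coeff p 1) h
    have h0 := congrArg (fun p => coeff p 0) h
    simp [coeff_X, coeff_C, coeff_X_pow] at h0 h1 h2 h3
    exact ⟨h3, h2, h1, h0⟩
  have hp : (C a * X ^ 3 + C b * X ^ 2 + C c * X + C d : ℝ[X]) ^ 2 * (X - C 9)
      = (C a₂ * X ^ 3 + C b₂ * X ^ 2 + C c₂ * X + C d₂) ^ 2 * (X - C 1) := by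
    apply Polynomial.eq_of_infinite_eval_eq
    refine (Set.Ioi_infinite (9 : ℝ)).mono ?_
    intro t ht
    have := h t ht
    simpa using this
  have hP := aux_poly _ _ hp
  refine ⟨key _ _ _ _ hP, key _ _ _ _ ?_⟩
  rw [hP] at hp
  have h1 : (X - C (1 : ℝ)) ≠ 0 := X_sub_C_ne_zero 1
  have : (C a₂ * X ^ 3 + C b₂ * X ^ 2 + C c₂ * X + C d₂ : ℝ[X]) ^ 2 * (X - C 1) = 0 := by
    rw [← hp]; ring
  exact pow_eq_zero_iff (two_ne_zero) |>.1 ((mul_eq_zero.1 this).resolve_right h1)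

/-- The nine functions are linearly independent on `(3, ∞)`. -/
theorem lin_indep_nine :
    ∀ c : Fin 9 → ℝ,
      (∀ x ∈ Set.Ioi (3 : ℝ), ∑ i, c i * gTeoC i x = 0) → ∀ i, c i = 0 := by
  intro c h
  have hF : ∀ x : ℝ, 3 < x →
      (√(x ^ 2 - 1 ^ 2) * (c 0 + c 2 / x ^ 2 + (2 * c 3) / x ^ 4)
        + (2 * c 1 - c 8) * Real.arcsin (1 / x))
      + (√(x ^ 2 - 3 ^ 2) * (c 4 + c 6 / x ^ 2 + (6 * c 7) / x ^ 4)
        + (c 8 - 2 * c 5) * Real.arcsin (3 / x)) = - (Real.pi * (c 1 + c 5)) := by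
    intro x hx
    have h0 : 0 < x := by linarith
    have := h x hx
    simp only [Fin.sum_univ_succ, gTeoC] at this
    simp [-one_div, Fin.succ] at this
    rw [aux_cos 1 x one_pos (by linarith), aux_cos 3 x (by norm_num) hx,
      aux_sin 1 x one_pos (by linarith), aux_sin 3 x (by norm_num) hx] at this
    generalize √(x ^ 2 - 1 ^ 2) = u at *
    generalize √(x ^ 2 - 3 ^ 2) = v at *
    generalize Real.arcsin (1 / x) = A at *
    generalize Real.arcsin (3 / x) = B at *
    field_simp at this ⊢
    linear_combination this
  have hD : ∀ r : ℝ, 3 < r → _ := fun r hr =>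
    ((aux_deriv 1 (c 0) (c 2) (2 * c 3) (2 * c 1 - c 8) r one_pos (by linarith)).add
      (aux_deriv 3 (c 4) (c 6) (6 * c 7) (c 8 - 2 * c 5) r (by norm_num) hr)).unique
      ((hasDerivAt_const r (- (Real.pi * (c 1 + c 5)))).congr_of_eventuallyEq
        (Filter.eventually_of_mem (Ioi_mem_nhds hr) hF))
  have hC := aux_coeff (c 0) (-c 2 - (2 * c 1 - c 8)) (2 * c 2 - 6 * c 3) (8 * c 3)
    (c 4) (-c 6 - 3 * (c 8 - 2 * c 5)) (18 * c 6 - 18 * c 7) (216 * c 7) (by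
      intro t ht
      have hr : 3 < √t := Real.lt_sqrt_of_sq_lt (by linarith)
      have := hD (√t) hr
      have hu := aux_pos 1 (√t) one_pos (by linarith)
      have hv := aux_pos 3 (√t) (by norm_num) hr
      have e2 : √t ^ 2 = t := Real.sq_sqrt (by linarith)
      have e4 : √t ^ 4 = t ^ 2 := by rw [← e2]; simp [← pow_mul]
      have e6 : √t ^ 6 = t ^ 3 := by rw [← e2]; simp [← pow_mul]
      have u2 : √(√t ^ 2 - 1 ^ 2) ^ 2 = t - 1 := by
        rw [Real.sq_sqrt (by nlinarith), e2]; norm_num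
      have v2 : √(√t ^ 2 - 3 ^ 2) ^ 2 = t - 9 := by
        rw [Real.sq_sqrt (by nlinarith), e2]; norm_num
      generalize √(√t ^ 2 - 1 ^ 2) = u at *
      generalize √(√t ^ 2 - 3 ^ 2) = v at *
      rw [e2, e4, e6] at this
      have hw : 0 < √t ^ 5 := by positivity
      generalize √t ^ 5 = w at *
      rw [div_add_div _ _ (by positivity) (by positivity), div_eq_zero_iff] at this
      have this := this.resolve_right (by positivity)
      have h5 : (c 0 * t ^ 3 + (-c 2 - (2 * c 1 - c 8)) * t ^ 2 + (2 * c 2 - 6 * c 3) * t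
          + 8 * c 3) * v = - ((c 4 * t ^ 3 + (-c 6 - 3 * (c 8 - 2 * c 5)) * t ^ 2
          + (18 * c 6 - 18 * c 7) * t + 216 * c 7) * u) := by
        apply mul_right_cancel₀ hw.ne'
        linear_combination this
      rw [← u2, ← v2, ← mul_pow, ← mul_pow, h5, neg_sq])
  obtain ⟨⟨h0, h1, h2, h3⟩, h4, h5, h6, h7⟩ := hC
  have c3 : c 3 = 0 := by linarith
  have c2 : c 2 = 0 := by linarith
  have c7 : c 7 = 0 := by linarith
  have c6 : c 6 = 0 := by linarith
  have k1 : 2 * c 1 - c 8 = 0 := by linarith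
  have k2 : c 8 - 2 * c 5 = 0 := by linarith
  have hpi := hF 4 (by norm_num)
  rw [h0, c2, c3, k1, h4, c6, c7, k2] at hpi
  have k3 : c 1 + c 5 = 0 := by
    have : Real.pi * (c 1 + c 5) = 0 := by
      simp at hpi
      simpa using hpi
    exact (mul_eq_zero.1 this).resolve_left Real.pi_ne_zero
  have c1 : c 1 = 0 := by linarith
  have c5 : c 5 = 0 := by linarith
  have c8 : c 8 = 0 := by linarith
  intro i
  fin_cases i <;> assumption
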